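/- arXiv:1907.12007 — 2 statements merged into one kernel-verified Lean document; each statement's English description precedes it below -/
import Mathlib

section
/- For every n ≥ 2, the special algebra S(n) is spanned over F by the derivations D_{ij}(x^α) = α_j·x^{α−ε_j}∂_i − α_i·x^{α−ε_i}∂_j for α ∈ ℕ^n and 1 ≤ i < j ≤ n (where ε_k is the k-th standard multi-index, and a term is interpreted as 0 if the exponent has a negative entry): every divergence-free polynomial vector field is a finite F-linear combination of such D_{ij}(x^α). -/
open MvPolynomial

noncomputable section

abbrev Wn (F : Type*) [Field F] (n : ℕ) :=
  Derivation F (MvPolynomial (Fin n) F) (MvPolynomial (Fin n) F)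

/-- The divergence of a polynomial vector field. -/
def divg {F : Type*} [Field F] {n : ℕ} (D : Wn F n) : MvPolynomial (Fin n) F :=
  ∑ i, pderiv i (D (X i))

/-- `D_{ij}(f) = ∂_j(f)·∂_i − ∂_i(f)·∂_j`; in particular
`D_{ij}(x^α) = α_j x^{α−ε_j}∂_i − α_i x^{α−ε_i}∂_j`. -/
def Dij {F : Type*} [Field F] {n : ℕ} (i j : Fin n) (f : MvPolynomial (Fin n) F) :
    Wn F n :=
  (pderiv j f) • (pderiv i : Wn F n) - (pderiv i f) • (pderiv j : Wn F n)

/-- Formal antidifferentiation with respect to the variable `X i`. -/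
def antideriv {F : Type*} [Field F] {n : ℕ} (i : Fin n) :
    MvPolynomial (Fin n) F →ₗ[F] MvPolynomial (Fin n) F :=
  (basisMonomials (Fin n) F).constr F
    fun α => monomial (α + Finsupp.single i 1) ((α i : F) + 1)⁻¹

theorem antideriv_monomial {F : Type*} [Field F] {n : ℕ} (i : Fin n) (α : Fin n →₀ ℕ) :
    antideriv i (monomial α (1 : F)) =
      monomial (α + Finsupp.single i 1) ((α i : F) + 1)⁻¹ := by
  have h := (basisMonomials (Fin n) F).constr_basis F
    (fun α => monomial (α + Finsupp.single i 1) ((α i : F) + 1)⁻¹) α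
  rwa [coe_basisMonomials] at h

theorem pderiv_antideriv {F : Type*} [Field F] [CharZero F] {n : ℕ} (i : Fin n)
    (f : MvPolynomial (Fin n) F) : pderiv i (antideriv i f) = f := by
  have h : (pderiv i : Wn F n).toLinearMap ∘ₗ antideriv i = LinearMap.id := by
    refine (basisMonomials (Fin n) F).ext fun α => ?_
    have hα : (α i : F) + 1 ≠ 0 := Nat.cast_add_one_ne_zero _
    simp [antideriv_monomial, pderiv_monomial, hα]
  exact LinearMap.congr_fun h f

theorem pderiv_antideriv_comm {F : Type*} [Field F] {n : ℕ} {i j : Fin n} (hij : i ≠ j)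
    (f : MvPolynomial (Fin n) F) :
    pderiv i (antideriv j f) = antideriv j (pderiv i f) := by
  have h : (pderiv i : Wn F n).toLinearMap ∘ₗ antideriv j =
      antideriv j ∘ₗ (pderiv i : Wn F n).toLinearMap := by
    refine (basisMonomials (Fin n) F).ext fun α => ?_
    have hmon (β : Fin n →₀ ℕ) (c : F) : monomial β c = c • monomial β (1 : F) := by
      simp [smul_monomial]
    simp only [coe_basisMonomials, LinearMap.comp_apply, Derivation.coeFn_coe,
      antideriv_monomial, pderiv_monomial]
    rw [hmon _ (1 * _), map_smul, antideriv_monomial, smul_monomial]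
    by_cases hα : α i = 0
    · simp [hα, hij]
    · have hexp : α + Finsupp.single j 1 - Finsupp.single i 1 =
          α - Finsupp.single i 1 + Finsupp.single j 1 := by
        refine tsub_add_eq_add_tsub ?_ |>.symm
        exact Finsupp.single_le_iff.2 (Nat.one_le_iff_ne_zero.2 hα)
      rw [hexp]
      simp [hij, Ne.symm hij, mul_comm]
  exact LinearMap.congr_fun h f

theorem Dij_mem_span {F : Type*} [Field F] {n : ℕ} (i j : Fin n)
    (f : MvPolynomial (Fin n) F) :
    Dij i j f ∈ Submodule.span F {E : Wn F n |
      ∃ (i j : Fin n) (α : Fin n →₀ ℕ), i < j ∧ E = Dij i j (monomial α 1)} := by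
  have hadd (f g : MvPolynomial (Fin n) F) : Dij i j (f + g) = Dij i j f + Dij i j g := by
    simp only [Dij, map_add, add_smul]
    abel
  have hsmul (c : F) (f : MvPolynomial (Fin n) F) : Dij i j (c • f) = c • Dij i j f := by
    simp only [Dij, Derivation.map_smul, smul_assoc, smul_sub]
  have hswap (f : MvPolynomial (Fin n) F) : Dij i j f = -Dij j i f := by
    simp only [Dij, neg_sub]
  induction f using MvPolynomial.induction_on' with
  | monomial α c =>
    have hc : monomial α c = c • monomial α (1 : F) := by simp [smul_monomial]
    rw [hc, hsmul]
    refine Submodule.smul_mem _ _ ?_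
    rcases lt_trichotomy i j with hij | rfl | hij
    · exact Submodule.subset_span ⟨i, j, α, hij, rfl⟩
    · simp [Dij]
    · rw [hswap]
      exact Submodule.neg_mem _ (Submodule.subset_span ⟨j, i, α, hij, rfl⟩)
  | add p q hp hq =>
    rw [hadd]
    exact Submodule.add_mem _ hp hq

theorem eq_sum_Dij_add {F : Type*} [Field F] [CharZero F] {n : ℕ} (k : Fin n) (D : Wn F n) :
    D = ∑ i, Dij i k (antideriv k (D (X i))) +
      (∑ i, pderiv i (antideriv k (D (X i)))) • (pderiv k : Wn F n) := by
  rw [Finset.sum_smul, ← Finset.sum_add_distrib]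
  simp only [Dij, pderiv_antideriv, sub_add_cancel]
  refine derivation_ext fun j => ?_
  have hsum : ⇑(∑ i, D (X i) • (pderiv i : Wn F n)) = ∑ i, ⇑(D (X i) • (pderiv i : Wn F n)) :=
    map_sum Derivation.coeFnAddMonoidHom _ _
  rw [hsum]
  simp [Finset.sum_apply, pderiv_X, Pi.single_apply]

theorem pderiv_sum_pderiv_antideriv {F : Type*} [Field F] [CharZero F] {n : ℕ} (k : Fin n)
    (D : Wn F n) : pderiv k (∑ i, pderiv i (antideriv k (D (X i)))) = divg D := by
  rw [map_sum, divg]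
  refine Finset.sum_congr rfl fun i _ => ?_
  by_cases hik : i = k
  · rw [hik, pderiv_antideriv]
  · rw [pderiv_antideriv_comm hik, pderiv_antideriv]

/-- for `n ≥ 2`, every divergence-free polynomial vector field is
an `F`-linear combination of the derivations `D_{ij}(x^α)`, `α ∈ ℕ^n`,
`1 ≤ i < j ≤ n`. -/
theorem stmt5 (F : Type*) [Field F] [CharZero F] (n : ℕ) (hn : 2 ≤ n) :
    ∀ D : Wn F n, divg D = 0 →
      D ∈ Submodule.span F {E : Wn F n |
        ∃ (i j : Fin n) (α : Fin n →₀ ℕ), i < j ∧ E = Dij i j (monomial α 1)} := by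
  intro D hD
  let k : Fin n := ⟨0, by omega⟩
  let l : Fin n := ⟨1, by omega⟩
  have hkl : k ≠ l := by simp [k, l]
  rw [eq_sum_Dij_add k D]
  refine Submodule.add_mem _ (Submodule.sum_mem _ fun i _ => Dij_mem_span i k _) ?_
  set h := ∑ i, pderiv i (antideriv k (D (X i))) with hh
  have hk : pderiv k h = 0 := by rw [hh, pderiv_sum_pderiv_antideriv, hD]
  have hDkl : h • (pderiv k : Wn F n) = Dij k l (antideriv l h) := by
    simp only [Dij, pderiv_antideriv, pderiv_antideriv_comm hkl, hk, map_zero, zero_smul,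
      sub_zero]
  rw [hDkl]
  exact Dij_mem_span k l _
end
end

section
/- Let r ≥ 1 and n = 2r. For every integer i ≥ 2, the homogeneous component H(2r)_{[i]} = {D_H(f) : f ∈ P_{2r} homogeneous of degree i+2} of the Hamiltonian algebra is contained in the F-linear span of the brackets [A,B] with A ∈ H(2r)_{[i−1]} and B ∈ H(2r)_{[1]}. -/
open MvPolynomial

noncomputable section

/-- The submodule of polynomials homogeneous of integer degree `d`
(for `d < 0` this is `⊥`). -/
def homZ (F : Type*) [Field F] (n : ℕ) (d : ℤ) : Submodule F (MvPolynomial (Fin n) F) where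
  carrier := {p | ∀ m : Fin n →₀ ℕ, coeff m p ≠ 0 → (m.sum fun _ e => (e : ℤ)) = d}
  zero_mem' := by intro m hm; simp at hm
  add_mem' := by
    intro p q hp hq m hm
    by_cases h : coeff m p = 0
    · refine hq m fun hq0 => hm ?_
      simp [coeff_add, h, hq0]
    · exact hp m h
  smul_mem' := by
    intro c p hp m hm
    refine hp m fun h => hm ?_
    simp [coeff_smul, h]

/-- `σ(i) = 1` for `i ≤ r`, `σ(i) = -1` for `i > r` (indices `0,…,2r-1` here). -/
def sgn (F : Type*) [Field F] (r : ℕ) (i : Fin (2 * r)) : F :=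
  if (i : ℕ) < r then 1 else -1

/-- `i ↦ i′`, i.e. `i + r` for `i ≤ r` and `i - r` for `i > r`. -/
def prime (r : ℕ) (i : Fin (2 * r)) : Fin (2 * r) :=
  if h : (i : ℕ) < r then ⟨(i : ℕ) + r, by omega⟩
  else ⟨(i : ℕ) - r, by have := i.isLt; omega⟩

/-- The Hamiltonian vector field `D_H(f) = ∑ σ(i)·∂_i(f)·∂_{i′}`. -/
def DH {F : Type*} [Field F] {r : ℕ} (f : MvPolynomial (Fin (2 * r)) F) : Wn F (2 * r) :=
  ∑ i : Fin (2 * r), (sgn F r i • (pderiv i f)) • (pderiv (prime r i) : Wn F (2 * r))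

/-- The homogeneous component `H(2r)_{[i]} = {D_H(f) : f homogeneous of degree i+2}`. -/
def Hgr (F : Type*) [Field F] (r : ℕ) (i : ℤ) : Set (Wn F (2 * r)) :=
  {D | ∃ f ∈ homZ F (2 * r) (i + 2), D = DH f}

theorem mem_homZ_natCast {F : Type*} [Field F] {n d : ℕ} {p : MvPolynomial (Fin n) F} :
    p ∈ homZ F n d ↔ p.IsHomogeneous d := by
  refine forall_congr' fun m => imp_congr_right fun _ => ?_
  rw [Finsupp.weight_apply]
  simp only [Finsupp.sum, Pi.one_apply, smul_eq_mul, mul_one]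
  exact_mod_cast Iff.rfl

/-- In characteristic zero every homogeneous polynomial has a homogeneous antiderivative with
respect to any given variable. -/
theorem exists_isHomogeneous_pderiv_eq {F σ : Type*} [Field F] [CharZero F] {d : ℕ}
    {h : MvPolynomial σ F} (hh : h.IsHomogeneous d) (j : σ) :
    ∃ f : MvPolynomial σ F, f.IsHomogeneous (d + 1) ∧ pderiv j f = h := by
  refine ⟨∑ m ∈ h.support, monomial (m + Finsupp.single j 1) (coeff m h / (m j + 1)), ?_, ?_⟩
  · refine IsHomogeneous.sum _ _ _ fun m hm => isHomogeneous_monomial _ ?_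
    have : m.degree = d := by
      rw [Finsupp.degree_eq_weight_one]
      exact hh (mem_support_iff.mp hm)
    simp [this]
  · conv_rhs => rw [h.as_sum]
    rw [map_sum]
    refine Finset.sum_congr rfl fun m _ => ?_
    have : (m j : F) + 1 ≠ 0 := Nat.cast_add_one_ne_zero _
    simp [pderiv_monomial, this]

theorem prime_prime (r : ℕ) (i : Fin (2 * r)) : prime r (prime r i) = i := by
  have := i.isLt
  ext
  by_cases h : (i : ℕ) < r
  · simp [prime, h]
  · have : (i : ℕ) - r < r := by omega
    simp only [prime, h, this, dif_pos, dif_neg, not_false_eq_true]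
    omega

theorem sgn_prime (F : Type*) [Field F] (r : ℕ) (i : Fin (2 * r)) :
    sgn F r (prime r i) = -sgn F r i := by
  have := i.isLt
  by_cases h : (i : ℕ) < r
  · simp [sgn, prime, h]
  · have : (i : ℕ) - r < r := by omega
    simp [sgn, prime, h, this]

theorem sgn_ne_zero (F : Type*) [Field F] (r : ℕ) (i : Fin (2 * r)) : sgn F r i ≠ 0 := by
  unfold sgn
  split_ifs <;> simp

section Hamiltonian

variable {F : Type*} [Field F] {r : ℕ}

theorem DH_apply (f g : MvPolynomial (Fin (2 * r)) F) :
    DH f g = ∑ i, sgn F r i • (pderiv i f * pderiv (prime r i) g) := by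
  have h := congrFun (map_sum (Derivation.coeFnAddMonoidHom (R := F)
    (A := MvPolynomial (Fin (2 * r)) F) (M := MvPolynomial (Fin (2 * r)) F))
    (fun i => (sgn F r i • pderiv i f) • (pderiv (prime r i) : Wn F (2 * r))) Finset.univ) g
  rw [Finset.sum_apply] at h
  exact h.trans (by simp)

theorem DH_apply_X (f : MvPolynomial (Fin (2 * r)) F) (k : Fin (2 * r)) :
    DH f (X k) = sgn F r (prime r k) • pderiv (prime r k) f := by
  rw [DH_apply, Finset.sum_eq_single (prime r k)]
  · simp [prime_prime]
  · intro i _ hi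
    have : k ≠ prime r i := fun h => hi (by rw [h, prime_prime])
    simp [pderiv_X_of_ne this]
  · simp

theorem DH_apply_comm (f g : MvPolynomial (Fin (2 * r)) F) : DH f g = -DH g f := by
  rw [DH_apply, DH_apply, ← Finset.sum_neg_distrib]
  refine Finset.sum_bij' (fun i _ => prime r i) (fun i _ => prime r i) ?_ ?_ ?_ ?_ ?_ <;>
    simp [prime_prime, sgn_prime, mul_comm]

theorem pderiv_DH_apply (f g : MvPolynomial (Fin (2 * r)) F) (j : Fin (2 * r)) :
    pderiv j (DH f g) = DH (pderiv j f) g + DH f (pderiv j g) := by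
  have comm (a b : Fin (2 * r)) (u : MvPolynomial (Fin (2 * r)) F) :
      pderiv a (pderiv b u) = pderiv b (pderiv a u) := by
    have h : ⁅(pderiv a : Wn F (2 * r)), (pderiv b : Wn F (2 * r))⁆ = 0 := by
      refine MvPolynomial.derivation_ext (R := F) fun k => ?_
      simp [Derivation.commutator_apply, pderiv_X, Pi.single_apply, apply_ite]
    simpa [Derivation.commutator_apply, sub_eq_zero] using DFunLike.congr_fun h u
  simp only [DH_apply, map_sum, Derivation.map_smul, Derivation.leibniz, smul_eq_mul,
    ← Finset.sum_add_distrib, ← smul_add]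
  refine Finset.sum_congr rfl fun i _ => ?_
  rw [comm j i f, comm j (prime r i) g]
  ring_nf

theorem lie_DH (f g : MvPolynomial (Fin (2 * r)) F) : ⁅DH f, DH g⁆ = DH (DH f g) := by
  refine MvPolynomial.derivation_ext (R := F) fun k => ?_
  rw [Derivation.commutator_apply, DH_apply_X, DH_apply_X, DH_apply_X, pderiv_DH_apply,
    Derivation.map_smul, Derivation.map_smul, DH_apply_comm (pderiv _ f) g, smul_add, smul_neg]
  ring

variable (F r) in
/-- The map `f ↦ D_H(f)` as a linear map. -/
def DHLinear : MvPolynomial (Fin (2 * r)) F →ₗ[F] Wn F (2 * r) where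
  toFun := DH
  map_add' f g := by
    refine Derivation.ext fun u => ?_
    simp [DH_apply, add_mul, Finset.sum_add_distrib]
  map_smul' c f := by
    refine Derivation.ext fun u => ?_
    simp [DH_apply, Finset.smul_sum, smul_comm c]

/-- A subspace containing all Poisson brackets of homogeneous polynomials of degrees `k + 1`
and `3` contains the product of any two variables with any homogeneous polynomial of degree `k`. -/
theorem X_mul_X_mul_mem [CharZero F] {k : ℕ} {S : Submodule F (MvPolynomial (Fin (2 * r)) F)}
    (hS : ∀ f g : MvPolynomial (Fin (2 * r)) F,
      f.IsHomogeneous (k + 1) → g.IsHomogeneous 3 → DH f g ∈ S)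
    (p q : Fin (2 * r)) {h : MvPolynomial (Fin (2 * r)) F} (hh : h.IsHomogeneous k) :
    X p * X q * h ∈ S := by
  have hom3 (a b : Fin (2 * r)) : (X a * X a * X b : MvPolynomial (Fin (2 * r)) F).IsHomogeneous 3 :=
    ((isHomogeneous_X F a).mul (isHomogeneous_X F a)).mul (isHomogeneous_X F b)
  have square {u : MvPolynomial (Fin (2 * r)) F} (hu : u.IsHomogeneous k) :
      X p * X p * u ∈ S := by
    obtain ⟨f, hf, rfl⟩ := exists_isHomogeneous_pderiv_eq hu (prime r p)
    have key : DH f (X p * X p * X p) =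
        (3 * sgn F r (prime r p)) • (X p * X p * pderiv (prime r p) f) := by
      simp only [Derivation.leibniz, DH_apply_X, smul_eq_mul, smul_eq_C_mul, map_mul, map_ofNat]
      ring
    have := hS f _ hf (hom3 p p)
    rw [key] at this
    exact (S.smul_mem_iff (mul_ne_zero three_ne_zero (sgn_ne_zero F r _))).mp this
  obtain ⟨f, hf, rfl⟩ := exists_isHomogeneous_pderiv_eq hh (prime r p)
  have key : DH f (X p * X p * X q) =
      (2 * sgn F r (prime r p)) • (X p * X q * pderiv (prime r p) f) +
        sgn F r (prime r q) • (X p * X p * pderiv (prime r q) f) := by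
    simp only [Derivation.leibniz, DH_apply_X, smul_eq_mul, smul_eq_C_mul, map_mul, map_ofNat]
    ring
  have := hS f _ hf (hom3 p q)
  rw [key] at this
  have hq := S.smul_mem (sgn F r (prime r q)) (square (hf.pderiv (i := prime r q)))
  exact (S.smul_mem_iff (mul_ne_zero two_ne_zero (sgn_ne_zero F r _))).mp
    ((S.add_mem_iff_left hq).mp this)

end Hamiltonian

/-- A nonconstant monomial is a variable times a monomial of degree one less. -/
theorem exists_monomial_eq_X_mul {F σ : Type*} [Field F] {d : ℕ} {m : σ →₀ ℕ}
    (hm : m.degree = d + 1) (c : F) :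
    ∃ (p : σ) (m' : σ →₀ ℕ), m'.degree = d ∧ monomial m c = X p * monomial m' c := by
  have h0 : m ≠ 0 := by
    rintro rfl
    simp at hm
  obtain ⟨p, hp⟩ := Finsupp.ne_iff.mp h0
  have hle : Finsupp.single p 1 ≤ m := by
    rw [Finsupp.single_le_iff]
    exact Nat.one_le_iff_ne_zero.mpr hp
  obtain ⟨m', rfl⟩ := exists_add_of_le hle
  refine ⟨p, m', ?_, ?_⟩
  · rw [map_add, Finsupp.degree_single] at hm
    omega
  · rw [X, monomial_mul, one_mul]

/-- for `r ≥ 1` and `i ≥ 2`, the component `H(2r)_{[i]}` is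
contained in the span of the brackets `[A, B]` with `A ∈ H(2r)_{[i−1]}`,
`B ∈ H(2r)_{[1]}`. -/
theorem stmt9 (F : Type*) [Field F] [CharZero F] (r : ℕ) (hr : 1 ≤ r) :
    ∀ i : ℤ, 2 ≤ i →
      Hgr F r i ⊆
        ↑(Submodule.span F {Z : Wn F (2 * r) |
          ∃ A ∈ Hgr F r (i - 1), ∃ B ∈ Hgr F r 1, Z = ⁅A, B⁆}) := by
  intro i hi
  obtain ⟨k, rfl⟩ := Int.eq_ofNat_of_zero_le (by omega : 0 ≤ i)
  rintro _ ⟨f, hf, rfl⟩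
  set T := Submodule.span F {Z : Wn F (2 * r) |
    ∃ A ∈ Hgr F r ((k : ℤ) - 1), ∃ B ∈ Hgr F r 1, Z = ⁅A, B⁆}
  have hT (u v : MvPolynomial (Fin (2 * r)) F) (hu : u.IsHomogeneous (k + 1))
      (hv : v.IsHomogeneous 3) : DH u v ∈ T.comap (DHLinear F r) := by
    refine Submodule.subset_span ⟨DH u, ⟨u, ?_, rfl⟩, DH v, ⟨v, ?_, rfl⟩, (lie_DH u v).symm⟩
    · convert mem_homZ_natCast.mpr hu using 2
      push_cast
      ring
    · exact_mod_cast mem_homZ_natCast.mpr hv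
  have hf' : f.IsHomogeneous (k + 2) := mem_homZ_natCast.mp (by exact_mod_cast hf)
  suffices f ∈ T.comap (DHLinear F r) from this
  rw [f.as_sum]
  refine Submodule.sum_mem _ fun m hm => ?_
  have hdeg : m.degree = k + 2 := by
    rw [Finsupp.degree_eq_weight_one]
    exact hf' (mem_support_iff.mp hm)
  obtain ⟨p, m₁, h₁, e₁⟩ := exists_monomial_eq_X_mul hdeg (coeff m f)
  obtain ⟨q, m₂, h₂, e₂⟩ := exists_monomial_eq_X_mul h₁ (coeff m f)
  rw [e₁, e₂, ← mul_assoc]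
  exact X_mul_X_mul_mem hT p q (isHomogeneous_monomial _ h₂)
end
end
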